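/- The subspace L is contained in every bi-Lagrangian subspace of V, and moreover L equals the intersection of all bi-Lagrangian subspaces of V. -/

import Mathlib

/-- The rank of a bilinear form `C` on `V`: `dim V - dim (ker C)`. -/
noncomputable def formRank {V : Type*} [AddCommGroup V] [Module ℂ V]
    (C : V →ₗ[ℂ] V →ₗ[ℂ] ℂ) : ℕ :=
  Module.finrank ℂ V - Module.finrank ℂ (LinearMap.ker C)

/-- A subspace `U` is bi-Lagrangian for a pencil of alternating forms `A + λB` of rank `r`
if it is isotropic for both `A` and `B` and `2 · dim U = 2 · dim V − r`. -/
def IsBiLagrangian {V : Type*} [AddCommGroup V] [Module ℂ V]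
    (A B : V →ₗ[ℂ] V →ₗ[ℂ] ℂ) (r : ℕ) (U : Submodule ℂ V) : Prop :=
  (∀ u ∈ U, ∀ u' ∈ U, A u u' = 0 ∧ B u u' = 0) ∧
    2 * Module.finrank ℂ U = 2 * Module.finrank ℂ V - r

namespace PencilAux

variable {V : Type*} [AddCommGroup V] [Module ℂ V]

theorem span_ortho (C : V →ₗ[ℂ] V →ₗ[ℂ] ℂ) (s t : Set V)
    (h : ∀ x ∈ s, ∀ y ∈ t, C x y = 0) :
    ∀ x ∈ Submodule.span ℂ s, ∀ y ∈ Submodule.span ℂ t, C x y = 0 := by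
  intro x hx y hy
  have h1 : ∀ x ∈ s, C x y = 0 := by
    intro x hx
    have : Submodule.span ℂ t ≤ LinearMap.ker (C x) := by
      rw [Submodule.span_le]
      intro z hz
      exact h x hx z hz
    exact this hy
  have : Submodule.span ℂ s ≤ LinearMap.ker (C.flip y) := by
    rw [Submodule.span_le]
    intro z hz
    exact h1 z hz
  exact this hx

theorem alt_neg (C : V →ₗ[ℂ] V →ₗ[ℂ] ℂ) (hC : ∀ v, C v v = 0) (x y : V) :
    C x y = - C y x := by
  have h := hC (x + y)
  simp only [map_add, LinearMap.add_apply, hC] at h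
  linear_combination h

theorem limit_mem [FiniteDimensional ℂ V] (N : V →ₗ[ℂ] V) (x : V) (W : Submodule ℂ V)
    (h : ∀ t : ℂ, t ≠ 0 → Function.Injective (1 + t • N : V →ₗ[ℂ] V) →
      ∀ y, (1 + t • N : V →ₗ[ℂ] V) y = x → y ∈ W) : x ∈ W := by
  classical
  let b := Module.finBasis ℂ V
  let M := LinearMap.toMatrix b b N
  let W' : Submodule ℂ (Fin (Module.finrank ℂ V) → ℂ) := W.map b.equivFun.toLinearMap
  have hcl : IsClosed (W' : Set (Fin (Module.finrank ℂ V) → ℂ)) :=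
    Submodule.closed_of_finiteDimensional W'
  let g : ℂ → (Fin (Module.finrank ℂ V) → ℂ) :=
    fun t => (1 + t • M).adjugate.mulVec (b.equivFun x)
  have hmc : Continuous (fun t : ℂ => 1 + t • M) := by fun_prop
  have hg : Continuous g := (hmc.matrix_adjugate).matrix_mulVec continuous_const
  have hd : Continuous (fun t : ℂ => (1 + t • M).det) := hmc.matrix_det
  have hev : ∀ᶠ t in nhdsWithin (0:ℂ) {0}ᶜ, g t ∈ (W' : Set _) := by
    have h1 : ∀ᶠ t in nhds (0:ℂ), (1 + t • M).det ≠ 0 := by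
      apply hd.continuousAt.eventually_ne
      simp
    filter_upwards [h1.filter_mono nhdsWithin_le_nhds, self_mem_nhdsWithin] with t ht ht0
    have hTm : LinearMap.toMatrix b b (1 + t • N : V →ₗ[ℂ] V) = 1 + t • M := by
      rw [map_add, map_smul, LinearMap.toMatrix_one]
    have hdet : LinearMap.det (1 + t • N : V →ₗ[ℂ] V) ≠ 0 := by
      rw [← LinearMap.det_toMatrix b, hTm]; exact ht
    have hinj : Function.Injective (1 + t • N : V →ₗ[ℂ] V) := by
      have := (LinearMap.equivOfDetNeZero _ hdet).injective
      exact this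
    obtain ⟨y, hy⟩ := (LinearMap.injective_iff_surjective.mp hinj) x
    have hyW := h t ht0 hinj y hy
    have hx : b.equivFun x = (1 + t • M).mulVec (b.equivFun y) := by
      rw [← hTm, ← hy]
      exact (LinearMap.toMatrix_mulVec_repr b b _ y).symm
    have : g t = (1 + t • M).det • b.equivFun y := by
      show (1 + t • M).adjugate.mulVec (b.equivFun x) = _
      rw [hx, Matrix.mulVec_mulVec, Matrix.adjugate_mul, Matrix.smul_mulVec, Matrix.one_mulVec]
    rw [this]
    exact W'.smul_mem _ (Submodule.mem_map_of_mem hyW)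
  have hlim : g 0 ∈ (W' : Set _) :=
    hcl.mem_of_tendsto (hg.continuousAt.tendsto.mono_left nhdsWithin_le_nhds) hev
  have h0 : g 0 = b.equivFun x := by simp [g]
  rw [h0] at hlim
  obtain ⟨w, hw, hwx⟩ := hlim
  have : w = x := b.equivFun.injective hwx
  exact this ▸ hw

theorem exists_geninv [FiniteDimensional ℂ V] (C : V →ₗ[ℂ] V →ₗ[ℂ] ℂ) :
    ∃ Φ : (V →ₗ[ℂ] ℂ) →ₗ[ℂ] V, (∀ v, C (Φ (C v)) = C v) ∧ ∀ z, C (Φ z) = 0 → Φ z = 0 := by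
  obtain ⟨S, hS⟩ := Submodule.exists_isCompl (LinearMap.ker C)
  have hinj : LinearMap.ker (C ∘ₗ S.subtype) = ⊥ := by
    rw [LinearMap.ker_eq_bot']
    intro m hm
    have h1 : (m : V) ∈ LinearMap.ker C ⊓ S := ⟨hm, m.2⟩
    rw [hS.inf_eq_bot] at h1
    exact Subtype.ext ((Submodule.mem_bot ℂ).mp h1)
  obtain ⟨g, hg⟩ := LinearMap.exists_leftInverse_of_injective _ hinj
  refine ⟨S.subtype ∘ₗ g, ?_, ?_⟩
  · intro v
    have hv : v ∈ LinearMap.ker C ⊔ S := by rw [hS.sup_eq_top]; trivial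
    obtain ⟨k, hk, s, hs, rfl⟩ := Submodule.mem_sup.mp hv
    have hk' : C k = 0 := hk
    have h2 : g (C s) = ⟨s, hs⟩ := LinearMap.congr_fun hg ⟨s, hs⟩
    simp [hk', h2]
  · intro z hz
    have h1 : (S.subtype ∘ₗ g) z ∈ LinearMap.ker C ⊓ S := ⟨hz, (g z).2⟩
    rw [hS.inf_eq_bot] at h1
    exact (Submodule.mem_bot ℂ).mp h1

theorem ker_le_of_others [FiniteDimensional ℂ V] (C B : V →ₗ[ℂ] V →ₗ[ℂ] ℂ)
    (hmin : ∀ t : ℂ, Module.finrank ℂ (LinearMap.ker C) ≤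
      Module.finrank ℂ (LinearMap.ker (C + t • B)))
    (W : Submodule ℂ V)
    (hW : ∀ t : ℂ, t ≠ 0 → Module.finrank ℂ (LinearMap.ker (C + t • B)) =
      Module.finrank ℂ (LinearMap.ker C) → LinearMap.ker (C + t • B) ≤ W) :
    LinearMap.ker C ≤ W := by
  intro x hx
  obtain ⟨Φ, h1, h2⟩ := exists_geninv C
  apply limit_mem (Φ ∘ₗ B) x W
  intro t ht hinj y hy
  have key : ∀ v, (1 + t • (Φ ∘ₗ B) : V →ₗ[ℂ] V) v = Φ ((C + t • B) v) + (v - Φ (C v)) := by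
    intro v
    simp
    abel
  have hle1 : LinearMap.ker (C + t • B) ≤ LinearMap.ker (Φ ∘ₗ (C + t • B)) :=
    LinearMap.ker_le_ker_comp _ _
  have hle2 : Module.finrank ℂ (LinearMap.ker (Φ ∘ₗ (C + t • B))) ≤
      Module.finrank ℂ (LinearMap.ker C) := by
    have hm : (LinearMap.ker (Φ ∘ₗ (C + t • B))).map (1 + t • (Φ ∘ₗ B) : V →ₗ[ℂ] V) ≤ LinearMap.ker C := by
      rintro _ ⟨v, hv, rfl⟩
      have hv' : Φ ((C + t • B) v) = 0 := hv
      rw [LinearMap.mem_ker, key, hv', zero_add, map_sub, h1, sub_self]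
    rw [(Submodule.equivMapOfInjective _ hinj _).finrank_eq]
    exact Submodule.finrank_mono hm
  have heq := Submodule.eq_of_le_of_finrank_le hle1 (hle2.trans (hmin t))
  have hfr : Module.finrank ℂ (LinearMap.ker (C + t • B)) = Module.finrank ℂ (LinearMap.ker C) :=
    le_antisymm (by rw [heq]; exact hle2) (hmin t)
  apply hW t ht hfr
  rw [heq, LinearMap.mem_ker, LinearMap.comp_apply]
  apply h2
  have h3 : Φ ((C + t • B) y) = x - (y - Φ (C y)) := by
    rw [← hy, key]; abel
  rw [h3, map_sub, map_sub, h1, LinearMap.mem_ker.mp hx]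
  simp

theorem exists_max [FiniteDimensional ℂ V] (C : V →ₗ[ℂ] V →ₗ[ℂ] ℂ) (hC : ∀ v, C v v = 0)
    (P : V →ₗ[ℂ] V) (M : Submodule ℂ V) (hPM : ∀ x ∈ M, P x ∈ M)
    (hP : ∀ x ∈ M, ∀ y ∈ M, C (P x) y = C x (P y)) (y : V) (hy : y ∈ M) :
    ∃ U : Submodule ℂ V, U ≤ M ∧ (∀ u ∈ U, P u ∈ U) ∧ (∀ u ∈ U, ∀ v ∈ U, C u v = 0) ∧ y ∈ U ∧
      ∀ z ∈ M, (∀ u ∈ U, C z u = 0) → z ∈ U := by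
  have hpow : ∀ (i : ℕ), ∀ x ∈ M, (P ^ i) x ∈ M := by
    intro i
    induction i with
    | zero => intro x hx; simpa using hx
    | succ k ih => intro x hx; rw [pow_succ']; exact hPM _ (ih x hx)
  have hadj : ∀ (i : ℕ), ∀ x ∈ M, ∀ y ∈ M, C ((P ^ i) x) y = C x ((P ^ i) y) := by
    intro i
    induction i with
    | zero => intro x _ y _; simp
    | succ k ih =>
      intro x hx y hy
      have e1 : (P ^ (k+1)) x = P ((P ^ k) x) := by rw [pow_succ']; rfl
      have e2 : (P ^ (k+1)) y = (P ^ k) (P y) := by rw [pow_succ]; rfl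
      rw [e1, e2, hP _ (hpow k x hx) _ hy, ih x hx _ (hPM y hy)]
  have step : ∀ U : Submodule ℂ V, U ≤ M → (∀ u ∈ U, P u ∈ U) →
      (∀ u ∈ U, ∀ v ∈ U, C u v = 0) → ∀ z ∈ M, (∀ u ∈ U, C z u = 0) →
      ∃ U' : Submodule ℂ V, U ≤ U' ∧ z ∈ U' ∧ U' ≤ M ∧ (∀ u ∈ U', P u ∈ U') ∧
        (∀ u ∈ U', ∀ v ∈ U', C u v = 0) := by
    intro U hUM hUP hUC z hz hzU
    have hUpow : ∀ (i : ℕ), ∀ x ∈ U, (P ^ i) x ∈ U := by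
      intro i
      induction i with
      | zero => intro x hx; simpa using hx
      | succ k ih => intro x hx; rw [pow_succ']; exact hUP _ (ih x hx)
    have hzu : ∀ (i : ℕ), ∀ u ∈ U, C ((P ^ i) z) u = 0 := by
      intro i u hu
      rw [hadj i z hz u (hUM hu)]
      exact hzU _ (hUpow i u hu)
    have hself : ∀ i : ℕ, C ((P ^ i) z) z = 0 := by
      intro i
      have h1 := hadj i z hz z hz
      have h2 := alt_neg C hC z ((P ^ i) z)
      rw [← h1] at h2
      exact self_eq_neg.mp h2
    refine ⟨Submodule.span ℂ ((U : Set V) ∪ Set.range (fun i : ℕ => (P ^ i) z)), ?_, ?_, ?_, ?_, ?_⟩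
    · intro u hu
      exact Submodule.subset_span (Or.inl hu)
    · exact Submodule.subset_span (Or.inr ⟨0, by simp⟩)
    · rw [Submodule.span_le]
      rintro x (hx | ⟨i, rfl⟩)
      · exact hUM hx
      · exact hpow i z hz
    · have : Submodule.span ℂ ((U : Set V) ∪ Set.range (fun i : ℕ => (P ^ i) z)) ≤
          (Submodule.span ℂ ((U : Set V) ∪ Set.range (fun i : ℕ => (P ^ i) z))).comap P := by
        refine Submodule.span_le.mpr ?_
        rintro x (hx | ⟨i, rfl⟩)
        · exact Submodule.subset_span (Or.inl (hUP x hx))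
        · exact Submodule.subset_span (Or.inr ⟨i+1, by simp [pow_succ']⟩)
      exact this
    · apply span_ortho
      rintro x (hx | ⟨i, rfl⟩) w (hw | ⟨j, rfl⟩)
      · exact hUC x hx w hw
      · rw [alt_neg C hC]; simp only [hzu j x hx, neg_zero]
      · exact hzu i w hw
      · simp only
        rw [← hadj j _ (hpow i z hz) z hz, ← Module.End.mul_apply, ← pow_add]
        exact hself _
  let F : Set (Submodule ℂ V) := {U | U ≤ M ∧ (∀ u ∈ U, P u ∈ U) ∧
    (∀ u ∈ U, ∀ v ∈ U, C u v = 0) ∧ y ∈ U}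
  have hne : F.Nonempty := by
    obtain ⟨U', -, h2, h3, h4, h5⟩ := step ⊥ bot_le (by simp) (by simp) y hy (by simp)
    exact ⟨U', h3, h4, h5, h2⟩
  obtain ⟨U, ⟨hU1, hU2, hU3, hU4⟩, hmax⟩ :=
    (wellFounded_gt (α := Submodule ℂ V)).has_min F hne
  refine ⟨U, hU1, hU2, hU3, hU4, ?_⟩
  intro z hz hzU
  obtain ⟨U', h1, h2, h3, h4, h5⟩ := step U hU1 hU2 hU3 z hz hzU
  by_contra hcon
  exact hmax U' ⟨h3, h4, h5, h1 hU4⟩ (lt_of_le_of_ne h1 (fun h => hcon (h ▸ h2)))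

/-- orthogonal complement -/
def orth (C : V →ₗ[ℂ] V →ₗ[ℂ] ℂ) (U : Submodule ℂ V) : Submodule ℂ V :=
  LinearMap.BilinForm.orthogonal C U

theorem mem_orth {C : V →ₗ[ℂ] V →ₗ[ℂ] ℂ} (hC : ∀ v, C v v = 0) {U : Submodule ℂ V} {x : V} :
    x ∈ orth C U ↔ ∀ u ∈ U, C x u = 0 := by
  unfold orth
  rw [LinearMap.BilinForm.mem_orthogonal_iff]
  constructor
  · intro h u hu
    rw [alt_neg C hC, show C u x = 0 from h u hu, neg_zero]
  · intro h u hu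
    show C u x = 0
    rw [alt_neg C hC, h u hu, neg_zero]

theorem finrank_orth [FiniteDimensional ℂ V] (C : V →ₗ[ℂ] V →ₗ[ℂ] ℂ) (hC : ∀ v, C v v = 0)
    (U : Submodule ℂ V) :
    Module.finrank ℂ U + Module.finrank ℂ (orth C U) =
      Module.finrank ℂ V + Module.finrank ℂ (U ⊓ LinearMap.ker C : Submodule ℂ V) := by
  have hrefl : LinearMap.IsRefl C := by
    intro x y h
    rw [alt_neg C hC, h, neg_zero]
  have h := LinearMap.BilinForm.finrank_add_finrank_orthogonal (B := C) hrefl U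
  have h2 : LinearMap.BilinForm.orthogonal C ⊤ = LinearMap.ker C := by
    ext x
    change x ∈ orth C ⊤ ↔ _
    rw [mem_orth hC, LinearMap.mem_ker]
    constructor
    · intro h; ext u; exact h u trivial
    · intro h u _; rw [h]; rfl
  rw [h2] at h
  exact h

end PencilAux

open PencilAux

/-- The subspace `L`, spanned by the kernels of the regular forms of the pencil, is
contained in every bi-Lagrangian subspace, and it equals the intersection of all
bi-Lagrangian subspaces. -/
theorem L_le_biLagrangian_and_eq_sInf
    (V : Type*) [AddCommGroup V] [Module ℂ V] [FiniteDimensional ℂ V]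
    (A B : V →ₗ[ℂ] V →ₗ[ℂ] ℂ)
    (hA : ∀ v : V, A v v = 0) (hB : ∀ v : V, B v v = 0)
    (r : ℕ)
    (hr_le : ∀ l : ℂ, formRank (A + l • B) ≤ r)
    (hr_ex : ∃ l : ℂ, formRank (A + l • B) = r)
    (L : Submodule ℂ V)
    (hL : L = Submodule.span ℂ
      (⋃ l ∈ {l : ℂ | formRank (A + l • B) = r}, (LinearMap.ker (A + l • B) : Set V))) :
    (∀ U : Submodule ℂ V, IsBiLagrangian A B r U → L ≤ U) ∧
      L = sInf {U : Submodule ℂ V | IsBiLagrangian A B r U} := by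
  have hreg : ∀ l : ℂ, formRank (A + l • B) = r ↔
      Module.finrank ℂ (LinearMap.ker (A + l • B)) + r = Module.finrank ℂ V := by
    intro l
    have h1 := Submodule.finrank_le (LinearMap.ker (A + l • B))
    unfold formRank
    obtain ⟨l0, h0⟩ := hr_ex
    have h2 := Submodule.finrank_le (LinearMap.ker (A + l0 • B))
    unfold formRank at h0
    omega
  have hge : ∀ l : ℂ,
      Module.finrank ℂ V ≤ Module.finrank ℂ (LinearMap.ker (A + l • B)) + r := by
    intro l
    have := hr_le l
    unfold formRank at this
    omega
  have halt : ∀ l : ℂ, ∀ v, (A + l • B) v v = 0 := by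
    intro l v
    simp [hA, hB]
  have hkerL : ∀ l : ℂ, formRank (A + l • B) = r → LinearMap.ker (A + l • B) ≤ L := by
    intro l hl x hx
    rw [hL]
    apply Submodule.subset_span
    simp only [Set.mem_iUnion]
    exact ⟨l, hl, hx⟩
  -- the kernel at `l` lies in any subspace containing all other regular kernels
  have hother : ∀ l : ℂ, formRank (A + l • B) = r → ∀ W : Submodule ℂ V,
      (∀ m : ℂ, m ≠ l → formRank (A + m • B) = r → LinearMap.ker (A + m • B) ≤ W) →
      LinearMap.ker (A + l • B) ≤ W := by
    intro l hl W hW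
    have hl' := (hreg l).mp hl
    have e : ∀ t : ℂ, A + l • B + t • B = A + (l + t) • B := by
      intro t; rw [add_smul, add_assoc]
    apply ker_le_of_others (A + l • B) B
    · intro t
      have := hge (l + t)
      rw [e]
      omega
    · intro t ht hfr
      rw [e] at hfr ⊢
      apply hW
      · simpa using ht
      · rw [hreg, hfr]; exact hl'
  have hLW : ∀ (l : ℂ) (W : Submodule ℂ V),
      (∀ m : ℂ, m ≠ l → formRank (A + m • B) = r → LinearMap.ker (A + m • B) ≤ W) → L ≤ W := by
    intro l W hW
    rw [hL, Submodule.span_le]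
    intro x hx
    simp only [Set.mem_iUnion] at hx
    obtain ⟨m, hm, hx⟩ := hx
    by_cases hml : m = l
    · subst hml
      exact hother m hm W hW hx
    · exact hW m hml hm hx
  have part1 : ∀ U : Submodule ℂ V, IsBiLagrangian A B r U → L ≤ U := by
    rintro U ⟨hU, hdim⟩
    rw [hL, Submodule.span_le]
    intro x hx
    simp only [Set.mem_iUnion] at hx
    obtain ⟨l, hl, hx⟩ := hx
    have hl' := (hreg l).mp hl
    have hle : U ⊔ LinearMap.ker (A + l • B) ≤
        orth (A + l • B) (U ⊔ LinearMap.ker (A + l • B)) := by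
      have hk : ∀ k ∈ LinearMap.ker (A + l • B), ∀ z, (A + l • B) k z = 0 := by
        intro k hk z
        rw [LinearMap.mem_ker.mp hk]; rfl
      intro v hv
      rw [mem_orth (halt l)]
      intro w hw
      obtain ⟨u, hu, k, hk1, rfl⟩ := Submodule.mem_sup.mp hv
      obtain ⟨u', hu', k', hk1', rfl⟩ := Submodule.mem_sup.mp hw
      have e1 : (A + l • B) u u' = 0 := by simp [hU u hu u' hu']
      have e2 := hk k hk1 (u' + k')
      have e3 : (A + l • B) u k' = 0 := by
        rw [alt_neg _ (halt l), hk k' hk1', neg_zero]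
      rw [LinearMap.map_add (A + l • B) u k, LinearMap.add_apply, e2, add_zero,
        LinearMap.map_add _ u' k', e1, e3, add_zero]
    have h1 := Submodule.finrank_mono hle
    have h2 := finrank_orth (A + l • B) (halt l) (U ⊔ LinearMap.ker (A + l • B))
    rw [inf_eq_right.mpr le_sup_right] at h2
    have h3 : U = U ⊔ LinearMap.ker (A + l • B) :=
      Submodule.eq_of_le_of_finrank_le le_sup_left (by omega)
    rw [SetLike.mem_coe, h3]
    exact le_sup_right (a := U) hx
  refine ⟨part1, le_antisymm (le_sInf part1) ?_⟩
  obtain ⟨l, hl⟩ := hr_ex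
  have hl' := (hreg l).mp hl
  set C : V →ₗ[ℂ] V →ₗ[ℂ] ℂ := A + l • B with hCdef
  have hC : ∀ v, C v v = 0 := halt l
  have hCB : ∀ (m : ℂ) (x k : V), k ∈ LinearMap.ker (A + m • B) →
      C x k = (l - m) * B x k := by
    intro m x k hk
    have h1 : (A + m • B) x k = 0 := by
      rw [alt_neg _ (halt m), LinearMap.mem_ker.mp hk]; simp
    simp only [hCdef, LinearMap.add_apply, LinearMap.smul_apply, smul_eq_mul] at h1 ⊢
    linear_combination h1
  -- `C`-orthogonal to `L` implies `B`-orthogonal to `L`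
  have hperp : ∀ x, (∀ u ∈ L, C x u = 0) → ∀ u ∈ L, B x u = 0 := by
    intro x hx
    have : L ≤ LinearMap.ker (B x) := by
      apply hLW l
      intro m hm hmr k hk
      have h1 := hCB m x k hk
      rw [hx k (hkerL m hmr hk)] at h1
      have h2 := mul_eq_zero.mp h1.symm
      exact h2.resolve_left (sub_ne_zero.mpr (Ne.symm hm))
    exact this
  have hLL : ∀ x ∈ L, ∀ y ∈ L, C x y = 0 := by
    -- kernels for different parameters are orthogonal for both forms
    have hdiff : ∀ m : ℂ, formRank (A + m • B) = r → ∀ x ∈ LinearMap.ker (A + m • B),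
        L ≤ LinearMap.ker (C x) := by
      intro m hm x hx
      apply hLW m
      intro p hp hpr k hk
      have h1 := hCB p x k hk
      have h2 := hCB m k x hx
      rw [alt_neg C hC, alt_neg B hB] at h2
      have h3 : (p - m) * B x k = 0 := by linear_combination h1 + h2
      have h4 := (mul_eq_zero.mp h3).resolve_left (sub_ne_zero.mpr hp)
      rw [LinearMap.mem_ker, h1, h4, mul_zero]
    intro x hx y hy
    have : L ≤ LinearMap.ker (C.flip y) := by
      conv_lhs => rw [hL]
      rw [Submodule.span_le]
      intro z hz
      simp only [Set.mem_iUnion] at hz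
      obtain ⟨m, hm, hz⟩ := hz
      exact hdiff m hm z hz hy
    exact this hx
  obtain ⟨Φ, hΦ, -⟩ := exists_geninv C
  have hKL : LinearMap.ker C ≤ L := hkerL l hl
  have hKM : LinearMap.ker C ≤ orth C L := by
    intro k hk
    rw [mem_orth hC]
    intro u _
    rw [LinearMap.mem_ker.mp hk]; rfl
  have hLM : L ≤ orth C L := fun x hx => (mem_orth hC).mpr (hLL x hx)
  have hMM : orth C (orth C L) = L := by
    symm
    apply Submodule.eq_of_le_of_finrank_le
    · intro x hx
      rw [mem_orth hC]
      intro u hu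
      rw [alt_neg C hC, (mem_orth hC).mp hu x hx, neg_zero]
    · have h1 := finrank_orth C hC L
      have h2 := finrank_orth C hC (orth C L)
      rw [inf_eq_right.mpr hKL] at h1
      rw [inf_eq_right.mpr hKM] at h2
      omega
  -- functionals vanishing on the kernel of `C` are in its range
  have hrange : ∀ f : V →ₗ[ℂ] ℂ, (∀ k ∈ LinearMap.ker C, f k = 0) → ∃ v, C v = f := by
    intro f hf
    have h1 : f ∈ LinearMap.range (LinearMap.dualMap (R := ℂ) (M₁ := V) (M₂ := Module.Dual ℂ V) C) := by
      rw [LinearMap.range_dualMap_eq_dualAnnihilator_ker]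
      rw [Submodule.mem_dualAnnihilator]
      exact hf
    obtain ⟨g, hg⟩ := h1
    obtain ⟨v, rfl⟩ := (Module.evalEquiv ℂ V).surjective g
    refine ⟨-v, ?_⟩
    ext w
    have h2 := LinearMap.congr_fun hg w
    rw [← h2, map_neg, LinearMap.neg_apply, ← alt_neg C hC]
    rfl
  have hPC : ∀ x ∈ orth C L, C ((Φ ∘ₗ B) x) = B x := by
    intro x hx
    obtain ⟨v, hv⟩ := hrange (B x)
      (fun k hk => hperp x ((mem_orth hC).mp hx) k (hKL hk))
    rw [LinearMap.comp_apply, ← hv, hΦ]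
  have hPM : ∀ x ∈ orth C L, (Φ ∘ₗ B) x ∈ orth C L := by
    intro x hx
    rw [mem_orth hC]
    intro u hu
    rw [hPC x hx]
    exact hperp x ((mem_orth hC).mp hx) u hu
  have hP : ∀ x ∈ orth C L, ∀ y ∈ orth C L, C ((Φ ∘ₗ B) x) y = C x ((Φ ∘ₗ B) y) := by
    intro x hx y hy
    rw [hPC x hx, alt_neg C hC x, hPC y hy, alt_neg B hB]
  -- through every vector of `L^⊥` there is a bi-Lagrangian subspace
  have hex : ∀ y ∈ orth C L, ∃ U, IsBiLagrangian A B r U ∧ y ∈ U := by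
    intro y hy
    obtain ⟨U, hUM, hUP, hUC, hyU, hUmax⟩ := exists_max C hC (Φ ∘ₗ B) (orth C L) hPM hP y hy
    have hLU : L ≤ U := by
      intro x hx
      apply hUmax x (hLM hx)
      intro u hu
      rw [alt_neg C hC, (mem_orth hC).mp (hUM hu) x hx, neg_zero]
    have hUo : orth C U = U := by
      apply le_antisymm
      · intro z hz
        rw [mem_orth hC] at hz
        exact hUmax z ((mem_orth hC).mpr fun u hu => hz u (hLU hu)) hz
      · intro z hz
        exact (mem_orth hC).mpr (hUC z hz)
    refine ⟨U, ⟨?_, ?_⟩, hyU⟩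
    · intro u hu u' hu'
      have h1 : B u u' = 0 := by
        rw [← hPC u (hUM hu)]
        exact hUC _ (hUP u hu) u' hu'
      have h2 := hUC u hu u' hu'
      simp only [hCdef, LinearMap.add_apply, LinearMap.smul_apply, h1, smul_zero, add_zero] at h2
      exact ⟨h2, h1⟩
    · have h1 := finrank_orth C hC U
      rw [hUo, inf_eq_right.mpr (hKL.trans hLU)] at h1
      omega
  intro x hx
  rw [Submodule.mem_sInf] at hx
  rw [← hMM, mem_orth hC]
  intro y hy
  obtain ⟨U, hU, hyU⟩ := hex y hy
  have h := hU.1 x (hx U hU) y hyU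
  simp [hCdef, h.1, h.2]
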